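/- arXiv:0808.2311 — 2 statements merged into one kernel-verified Lean document; each statement's English description precedes it below -/
import Mathlib

section
/- Let (A, A₁) be a Frobenius pair. The map ι_* : Spec_gr(B) → Spec_gr(B₁) given by ι_*(P) = P ∩ B₁ is a bijection, with inverse ι_*^{-1}(𝔭) = √(𝔭B). Moreover, if I is a right ideal of A and I₁ = I ∩ A₁, then Ch(A/I) = Ch(A/I₁A) = ι_*^{-1}(Ch(A₁/I₁)). -/
/-! ### Filtered rings and associated graded rings -/

/-- A (ℤ-indexed, increasing, exhaustive, separated) filtration on a ring `A`. -/
structure FilteredRing (A : Type) [Ring A] where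
  F : ℤ → AddSubgroup A
  mono : ∀ {m n : ℤ}, m ≤ n → F m ≤ F n
  one_mem : (1 : A) ∈ F 0
  mul_mem : ∀ {m n : ℤ} {x y : A}, x ∈ F m → y ∈ F n → x * y ∈ F (m + n)
  exhaustive : ∀ a : A, ∃ n : ℤ, a ∈ F n
  separated : ∀ a : A, (∀ n : ℤ, a ∈ F n) → a = 0

/-- Completeness of a filtered ring with respect to its filtration topology. -/
def FilteredRing.IsComplete {A : Type} [Ring A] (FA : FilteredRing A) : Prop :=
  ∀ u : ℕ → A, (∀ i : ℕ, u (i + 1) - u i ∈ FA.F (-(i : ℤ))) →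
    ∃ a : A, ∀ i : ℕ, a - u i ∈ FA.F (-(i : ℤ))

/-- A realization of the associated graded ring of the filtered ring `(A, FA)` as a ring `B`:
`B` is graded by subgroups `deg n` (with component projections `comp n`), and for each `n` the
symbol map `σ n : FA.F n →+ B` is surjective onto `deg n` with kernel `FA.F (n-1)`, and is
multiplicative on symbols.  This data pins `B` down as `gr A = ⊕ₙ F_nA / F_{n-1}A`. -/
structure GradedOf {A : Type} [Ring A] (FA : FilteredRing A) (B : Type) [Ring B] where
  deg : ℤ → AddSubgroup B
  one_mem : (1 : B) ∈ deg 0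
  mul_mem : ∀ {m n : ℤ} {x y : B}, x ∈ deg m → y ∈ deg n → x * y ∈ deg (m + n)
  comp : ℤ → B →+ B
  comp_mem : ∀ (n : ℤ) (b : B), comp n b ∈ deg n
  comp_of_mem : ∀ {n : ℤ} {b : B}, b ∈ deg n → comp n b = b
  comp_eq_zero : ∀ {m n : ℤ} {b : B}, b ∈ deg n → m ≠ n → comp m b = 0
  comp_finite : ∀ b : B, (Function.support fun n => comp n b).Finite
  comp_sum : ∀ b : B, ∑ᶠ n : ℤ, comp n b = b
  σ : ∀ n : ℤ, FA.F n →+ B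
  σ_mem : ∀ (n : ℤ) (x : FA.F n), σ n x ∈ deg n
  σ_surj : ∀ (n : ℤ), ∀ b ∈ deg n, ∃ x : FA.F n, σ n x = b
  σ_ker : ∀ (n : ℤ) (x : FA.F n), σ n x = 0 ↔ (x : A) ∈ FA.F (n - 1)
  σ_mul : ∀ {m n : ℤ} (x : FA.F m) (y : FA.F n) (h : (x : A) * (y : A) ∈ FA.F (m + n)),
    σ (m + n) ⟨(x : A) * (y : A), h⟩ = σ m x * σ n y

variable {A B : Type}

/-- The set of symbols of elements of a subset `I ⊆ A`; its span is `gr I`. -/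
def grSet [Ring A] [Ring B] (FA : FilteredRing A) (gr : GradedOf FA B) (I : Set A) : Set B :=
  {b : B | ∃ (n : ℤ) (x : FA.F n), (x : A) ∈ I ∧ gr.σ n x = b}

/-- The graded ideal `gr I` of `B = gr A` associated to a (one- or two-sided) ideal `I` of `A`. -/
def grIdeal [Ring A] [CommRing B] (FA : FilteredRing A) (gr : GradedOf FA B) (I : Set A) :
    Ideal B :=
  Ideal.span (grSet FA gr I)

/-- A subset of `B` is graded (homogeneous) if it is stable under all component projections. -/
def GradedOf.IsHomog [Ring A] [Ring B] {FA : FilteredRing A} (gr : GradedOf FA B)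
    (S : Set B) : Prop :=
  ∀ b ∈ S, ∀ n : ℤ, gr.comp n b ∈ S

/-- An element of `B` is homogeneous if it lies in some `deg n`. -/
def GradedOf.Homogeneous [Ring A] [Ring B] {FA : FilteredRing A} (gr : GradedOf FA B)
    (b : B) : Prop :=
  ∃ n : ℤ, b ∈ gr.deg n

/-- A homogeneous multiplicatively closed subset of the commutative ring `B`;
since `B` is commutative, such a set is automatically a (homogeneous) Ore set. -/
def IsHomogMulSet [Ring A] [Ring B] {FA : FilteredRing A} (gr : GradedOf FA B)
    (T : Set B) : Prop :=
  (1 : B) ∈ T ∧ (∀ b ∈ T, gr.Homogeneous b) ∧ (0 : B) ∉ T ∧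
    ∀ x ∈ T, ∀ y ∈ T, x * y ∈ T

/-- The image `B₁` of `gr A₁` in `B = gr A`, for a subring `A₁` of `A`. -/
def grImage [Ring A] [Ring B] (FA : FilteredRing A) (gr : GradedOf FA B)
    (A₁ : Subring A) : Subring B :=
  Subring.closure (grSet FA gr (A₁ : Set A))
/-! ### Frobenius pairs -/

/-- `(A, A₁)` is a Frobenius pair (in the sense of Ardakov–Wei–Zhang), relative to a
realization `gr : GradedOf FA B` of the associated graded ring `B` of `A`.  The subalgebra `A₁`
carries the subspace filtration, and `B₁` denotes the image of `gr A₁` in `B`. -/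
structure IsFrobeniusPair (p : ℕ) [Ring A] [CommRing B] (FA : FilteredRing A)
    (gr : GradedOf FA B) (A₁ : Subring A) : Prop where
  complete : FA.IsComplete
  closed : ∀ a : A, (∀ n : ℤ, ∃ x ∈ A₁, a - x ∈ FA.F n) → a ∈ A₁
  noetherian : IsNoetherianRing B
  domain : IsDomain B
  frob : ∀ b : B, b ^ p ∈ grImage FA gr A₁
  basis : ∃ (t : ℕ) (y : Fin t → B) (d : Fin t → ℤ),
    (∀ i, y i ∈ gr.deg (d i)) ∧
    (∀ b : B, ∃ c : (Fin t → Fin p) → B, (∀ α, c α ∈ grImage FA gr A₁) ∧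
      b = ∑ α : Fin t → Fin p, c α * ∏ i, y i ^ (α i : ℕ)) ∧
    ∀ c c' : (Fin t → Fin p) → B, (∀ α, c α ∈ grImage FA gr A₁) →
      (∀ α, c' α ∈ grImage FA gr A₁) →
      (∑ α : Fin t → Fin p, c α * ∏ i, y i ^ (α i : ℕ)) =
        (∑ α : Fin t → Fin p, c' α * ∏ i, y i ^ (α i : ℕ)) → c = c'

/-! ### Graded pieces and symbols -/

section Graded

variable [Ring A] [CommRing B] {FA : FilteredRing A} (gr : GradedOf FA B)

/-- Multiplication by a homogeneous element shifts the components. -/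
theorem GradedOf.comp_mul_of_mem {d : ℤ} {t : B} (ht : t ∈ gr.deg d) (c : B) (n : ℤ) :
    gr.comp n (c * t) = gr.comp (n - d) c * t := by
  have hfin := gr.comp_finite c
  have h1 : c * t = ∑ᶠ j : ℤ, gr.comp j c * t := by
    rw [← finsum_mul' _ _ hfin, gr.comp_sum]
  have hfin' : (Function.support fun j => gr.comp j c * t).Finite :=
    hfin.subset fun j hj h0 => hj (by simp only [h0, zero_mul])
  rw [h1, AddMonoidHom.map_finsum _ hfin', finsum_eq_single _ (n - d)]
  · exact gr.comp_of_mem (by simpa using gr.mul_mem (gr.comp_mem (n - d) c) ht)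
  · intro j hj
    exact gr.comp_eq_zero (gr.mul_mem (gr.comp_mem j c) ht) (by omega)

theorem GradedOf.pow_mem {d : ℤ} {t : B} (ht : t ∈ gr.deg d) (N : ℕ) :
    t ^ N ∈ gr.deg (N * d) := by
  induction N with
  | zero => simpa using gr.one_mem
  | succ N ih =>
    rw [pow_succ]
    convert gr.mul_mem ih ht using 2
    push_cast; ring

/-- `b` is the symbol of `x` in degree `n`. -/
def GradedOf.IsSymbol (n : ℤ) (x : A) (b : B) : Prop :=
  ∃ h : x ∈ FA.F n, gr.σ n ⟨x, h⟩ = b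

variable {gr}

theorem mem_grSet {I : Set A} {b : B} :
    b ∈ grSet FA gr I ↔ ∃ n, ∃ x ∈ I, gr.IsSymbol n x b :=
  ⟨fun ⟨n, x, hx, h⟩ => ⟨n, x, hx, x.2, h⟩, fun ⟨n, x, hx, h, e⟩ => ⟨n, ⟨x, h⟩, hx, e⟩⟩

namespace GradedOf.IsSymbol

variable {m n : ℤ} {x y : A} {b c : B}

theorem mem_deg (h : gr.IsSymbol n x b) : b ∈ gr.deg n := by
  obtain ⟨h, rfl⟩ := h
  exact gr.σ_mem _ _

theorem add (hx : gr.IsSymbol n x b) (hy : gr.IsSymbol n y c) :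
    gr.IsSymbol n (x + y) (b + c) := by
  obtain ⟨hx, rfl⟩ := hx
  obtain ⟨hy, rfl⟩ := hy
  exact ⟨add_mem hx hy, map_add (gr.σ n) ⟨x, hx⟩ ⟨y, hy⟩⟩

theorem neg (hx : gr.IsSymbol n x b) : gr.IsSymbol n (-x) (-b) := by
  obtain ⟨hx, rfl⟩ := hx
  exact ⟨neg_mem hx, map_neg (gr.σ n) ⟨x, hx⟩⟩

theorem sub (hx : gr.IsSymbol n x b) (hy : gr.IsSymbol n y c) :
    gr.IsSymbol n (x - y) (b - c) := by
  simpa [sub_eq_add_neg] using hx.add hy.neg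

theorem mul (hx : gr.IsSymbol m x b) (hy : gr.IsSymbol n y c) :
    gr.IsSymbol (m + n) (x * y) (b * c) := by
  obtain ⟨hx, rfl⟩ := hx
  obtain ⟨hy, rfl⟩ := hy
  exact ⟨FA.mul_mem hx hy, gr.σ_mul ⟨x, hx⟩ ⟨y, hy⟩ _⟩

theorem zero_iff : gr.IsSymbol n x 0 ↔ x ∈ FA.F (n - 1) :=
  ⟨fun ⟨h, e⟩ => (gr.σ_ker n ⟨x, h⟩).1 e, fun h =>
    have h' := FA.mono (by omega) h
    ⟨h', (gr.σ_ker n ⟨x, h'⟩).2 h⟩⟩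

theorem one : gr.IsSymbol 0 (1 : A) (1 : B) := by
  obtain ⟨x, hx⟩ := gr.σ_surj 0 1 gr.one_mem
  have hs : gr.IsSymbol 0 (x : A) (1 : B) := ⟨x.2, hx⟩
  have h1 : gr.IsSymbol 0 (1 : A) (gr.σ 0 ⟨1, FA.one_mem⟩) := ⟨FA.one_mem, rfl⟩
  have h2 := h1.mul hs
  simp only [one_mul, mul_one, add_zero] at h2
  obtain ⟨h3, e⟩ := h2
  have e1 : gr.σ 0 ⟨1, FA.one_mem⟩ = 1 := e.symm.trans hx
  exact e1 ▸ h1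

theorem pow (hx : gr.IsSymbol n x b) (N : ℕ) : gr.IsSymbol (N * n) (x ^ N) (b ^ N) := by
  induction N with
  | zero => simpa using one
  | succ N ih =>
    have := ih.mul hx
    rw [← pow_succ, ← pow_succ] at this
    convert this using 1
    push_cast; ring

theorem sum {ι : Type*} (s : Finset ι) {x : ι → A} {b : ι → B}
    (h : ∀ i ∈ s, gr.IsSymbol n (x i) (b i)) :
    gr.IsSymbol n (∑ i ∈ s, x i) (∑ i ∈ s, b i) := by
  classical
  induction s using Finset.induction_on with
  | empty => simp [zero_iff]
  | insert i s hi ih =>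
    rw [Finset.sum_insert hi, Finset.sum_insert hi]
    exact (h i (by simp)).add (ih fun j hj => h j (by simp [hj]))

/-- If `x ∈ I` and `y` have the same symbol of degree `q`, then `y ^ N` lies in `I` up to an error
whose degree drops by `N`. -/
theorem exists_pow_sub_mem {I : Submodule Aᵐᵒᵖ A} {q : ℤ} {x y : A} {c : B}
    (hx : gr.IsSymbol q x c) (hxI : x ∈ I) (hy : gr.IsSymbol q y c) (N : ℕ) :
    ∃ i ∈ I, y ^ N - i ∈ FA.F (N * (q - 1)) := by
  induction N with
  | zero => exact ⟨0, zero_mem _, by simpa using FA.one_mem⟩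
  | succ N ih =>
    obtain ⟨i, hi, hF⟩ := ih
    set a := y ^ N - i with ha
    obtain ⟨s, hs⟩ : ∃ s, gr.IsSymbol (N * (q - 1)) a s := ⟨_, hF, rfl⟩
    have h1 := hs.mul hy
    have h2 := hx.mul hs
    rw [add_comm, mul_comm c] at h2
    have h3 := GradedOf.IsSymbol.zero_iff.1 (by simpa using h1.sub h2)
    refine ⟨i * y + x * a, add_mem (I.smul_mem (.op y) hi) (I.smul_mem (.op a) hxI), ?_⟩
    have e : y ^ (N + 1) - (i * y + x * a) = a * y - x * a := by
      rw [ha, pow_succ]; noncomm_ring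
    rw [e]
    convert h3 using 2
    push_cast; ring

end GradedOf.IsSymbol

theorem natCast_eq_zero_of_gr {q : ℕ} (hq : (q : A) = 0) (gr : GradedOf FA B) :
    (q : B) = 0 := by
  have h := GradedOf.IsSymbol.sum (gr := gr) (Finset.range q) (x := fun _ => 1) (b := fun _ => 1)
    (n := 0) fun _ _ => GradedOf.IsSymbol.one
  simp only [Finset.sum_const, Finset.card_range, nsmul_eq_mul, mul_one, hq] at h
  obtain ⟨h0, e⟩ := h
  exact e.symm.trans (map_zero (gr.σ 0))

/-- The components of an element of `B₁` are symbols of elements of `A₁`. -/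
theorem exists_isSymbol_comp_of_mem_grImage {A₁ : Subring A} {b : B}
    (hb : b ∈ grImage FA gr A₁) (n : ℤ) : ∃ x ∈ A₁, gr.IsSymbol n x (gr.comp n b) := by
  let S : Submonoid B :=
    { carrier := grSet FA gr (A₁ : Set A)
      one_mem' := mem_grSet.2 ⟨0, 1, A₁.one_mem, .one⟩
      mul_mem' := by
        intro b c hb hc
        obtain ⟨m, x, hx, hxb⟩ := mem_grSet.1 hb
        obtain ⟨n, y, hy, hyc⟩ := mem_grSet.1 hc
        exact mem_grSet.2 ⟨_, _, A₁.mul_mem hx hy, hxb.mul hyc⟩ }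
  have hb' : b ∈ AddSubgroup.closure (S : Set B) := by
    have := Subring.mem_closure_iff.1 hb
    rwa [show Submonoid.closure (grSet FA gr (A₁ : Set A)) = S from Submonoid.closure_eq S] at this
  clear hb
  induction hb' using AddSubgroup.closure_induction with
  | mem b hb =>
    obtain ⟨m, x, hx, hxb⟩ := mem_grSet.1 hb
    by_cases hmn : n = m
    · subst hmn
      rw [gr.comp_of_mem hxb.mem_deg]
      exact ⟨x, hx, hxb⟩
    · rw [gr.comp_eq_zero hxb.mem_deg hmn]
      exact ⟨0, A₁.zero_mem, GradedOf.IsSymbol.zero_iff.2 (zero_mem _)⟩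
  | zero =>
    rw [map_zero]
    exact ⟨0, A₁.zero_mem, GradedOf.IsSymbol.zero_iff.2 (zero_mem _)⟩
  | add b c hb hc ihb ihc =>
    obtain ⟨x, hx, hxb⟩ := ihb
    obtain ⟨y, hy, hyc⟩ := ihc
    exact ⟨x + y, A₁.add_mem hx hy, by rw [map_add]; exact hxb.add hyc⟩
  | neg b hb ihb =>
    obtain ⟨x, hx, hxb⟩ := ihb
    exact ⟨-x, A₁.neg_mem hx, by rw [map_neg]; exact hxb.neg⟩

end Graded

/-! ### Completeness -/

section Complete

variable [Ring A] {FA : FilteredRing A}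

theorem FilteredRing.F_sub_mem_of_le {u : ℕ → A} {N : ℤ}
    (hu : ∀ i : ℕ, u (i + 1) - u i ∈ FA.F (N - i)) {i j : ℕ} (hij : i ≤ j) :
    u j - u i ∈ FA.F (N - i) := by
  induction j, hij using Nat.le_induction with
  | base => simp
  | succ j hj ih =>
    have := add_mem (FA.mono (by omega) (hu j)) ih
    simpa using this

theorem FilteredRing.IsComplete.exists_limit (hc : FA.IsComplete) {u : ℕ → A} {N : ℤ}
    (hu : ∀ i : ℕ, u (i + 1) - u i ∈ FA.F (N - i)) :
    ∃ a : A, ∀ i : ℕ, a - u i ∈ FA.F (N - i) := by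
  obtain ⟨e, he⟩ : ∃ e : ℕ, N ≤ e := ⟨N.toNat, by omega⟩
  obtain ⟨a, ha⟩ := hc (fun i => u (i + e)) fun i => by
    have := FA.mono (show N - ((i + e : ℕ) : ℤ) ≤ -(i : ℤ) by push_cast; omega) (hu (i + e))
    rwa [show i + e + 1 = i + 1 + e by omega] at this
  refine ⟨a, fun i => ?_⟩
  have h1 := ha (i + N.natAbs)
  have h2 : u (i + N.natAbs + e) - u i ∈ FA.F (N - i) := FA.F_sub_mem_of_le hu (by omega)
  have h3 := add_mem (FA.mono (show -((i + N.natAbs : ℕ) : ℤ) ≤ N - i by omega) h1) h2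
  simpa using h3

/-- Successive approximation: if the elements of `J` can be approximated, one filtration step at a
time, by combinations of the `g i` with coefficients in a closed subring `A₁`, then they are such
combinations, with the same control on the coefficients. -/
theorem FilteredRing.IsComplete.exists_eq_sum (hc : FA.IsComplete) {A₁ : Subring A}
    (hclosed : ∀ a : A, (∀ n : ℤ, ∃ x ∈ A₁, a - x ∈ FA.F n) → a ∈ A₁)
    {J : AddSubgroup A} (hJ : ∀ f ∈ J, ∀ a ∈ A₁, f * a ∈ J)
    {ι : Type*} [Fintype ι] {g : ι → A} {d : ι → ℤ}
    (hgJ : ∀ i, g i ∈ J) (hgd : ∀ i, g i ∈ FA.F (d i))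
    (happrox : ∀ (m : ℤ) (f : A), f ∈ FA.F m → f ∈ J → ∃ a : ι → A,
      (∀ i, a i ∈ A₁ ∧ a i ∈ FA.F (m - d i)) ∧ f - ∑ i, g i * a i ∈ FA.F (m - 1))
    {m : ℤ} {f : A} (hf : f ∈ FA.F m) (hfJ : f ∈ J) :
    ∃ a : ι → A, (∀ i, a i ∈ A₁ ∧ a i ∈ FA.F (m - d i)) ∧ f = ∑ i, g i * a i := by
  have happrox' : ∀ (m : ℤ) (f : A), ∃ a : ι → A, f ∈ FA.F m → f ∈ J →
      (∀ i, a i ∈ A₁ ∧ a i ∈ FA.F (m - d i)) ∧ f - ∑ i, g i * a i ∈ FA.F (m - 1) := by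
    intro m f
    by_cases h : f ∈ FA.F m ∧ f ∈ J
    · obtain ⟨a, ha⟩ := happrox m f h.1 h.2
      exact ⟨a, fun _ _ => ha⟩
    · exact ⟨0, fun h1 h2 => absurd ⟨h1, h2⟩ h⟩
  choose a ha using happrox'
  let r : ℕ → A := fun j => Nat.rec f (fun j x => x - ∑ i, g i * a (m - j) x i) j
  have hr_succ (j : ℕ) : r (j + 1) = r j - ∑ i, g i * a (m - j) (r j) i := rfl
  have hr (j : ℕ) : r j ∈ FA.F (m - j) ∧ r j ∈ J := by
    induction j with
    | zero => exact ⟨by simpa [r] using hf, hfJ⟩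
    | succ j ih =>
      obtain ⟨h1, h2⟩ := ha _ _ ih.1 ih.2
      refine ⟨?_, ?_⟩
      · rw [hr_succ]
        convert h2 using 2
        push_cast; ring
      · rw [hr_succ]
        exact sub_mem ih.2 (sum_mem fun i _ => hJ _ (hgJ i) _ (h1 i).1)
  have hcoeff (j : ℕ) := (ha _ _ (hr j).1 (hr j).2).1
  let u : ι → ℕ → A := fun i n => ∑ j ∈ Finset.range n, a (m - j) (r j) i
  have hu (i : ι) (n : ℕ) : u i (n + 1) - u i n ∈ FA.F (m - d i - n) := by
    simp only [u, Finset.sum_range_succ, add_sub_cancel_left]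
    convert (hcoeff n i).2 using 2
    ring
  choose l hl using fun i => hc.exists_limit (hu i)
  have hlF (i : ι) : l i ∈ FA.F (m - d i) := by simpa [u] using hl i 0
  have hlA (i : ι) : l i ∈ A₁ := by
    refine hclosed _ fun n => ⟨u i (m - d i - n).toNat, sum_mem fun j _ => (hcoeff j i).1, ?_⟩
    exact FA.mono (by omega) (hl i _)
  refine ⟨l, fun i => ⟨hlA i, hlF i⟩, ?_⟩
  have hru (n : ℕ) : r n = f - ∑ i, g i * u i n := by
    induction n with
    | zero => simp [r, u]
    | succ n ih =>
      have e : ∑ i, g i * u i (n + 1) = ∑ i, g i * u i n + ∑ i, g i * a (m - n) (r n) i := by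
        simp only [u, Finset.sum_range_succ, mul_add, Finset.sum_add_distrib]
      rw [hr_succ, e, ← sub_sub, ← ih]
  refine sub_eq_zero.1 (FA.separated _ fun n => ?_)
  have hrem (k : ℕ) : f - ∑ i, g i * l i ∈ FA.F (m - k) := by
    have e : f - ∑ i, g i * l i = r k - ∑ i, g i * (l i - u i k) := by
      simp only [hru, mul_sub, Finset.sum_sub_distrib]
      abel
    rw [e]
    refine sub_mem (hr k).1 (sum_mem fun i _ => ?_)
    convert FA.mul_mem (hgd i) (hl i k) using 2
    ring
  exact FA.mono (by omega) (hrem (m - n).toNat)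

end Complete

/-! ### Frobenius pairs -/

namespace IsFrobeniusPair

variable {p : ℕ} [Ring A] [CommRing B] {FA : FilteredRing A} {gr : GradedOf FA B}
  {A₁ : Subring A}

theorem moduleFinite (h : IsFrobeniusPair p FA gr A₁) : Module.Finite (grImage FA gr A₁) B := by
  obtain ⟨t, y, d, -, hgen, -⟩ := h.basis
  refine Module.Finite.of_surjective
    (Fintype.linearCombination (grImage FA gr A₁)
      fun α : Fin t → Fin p => ∏ i, y i ^ (α i : ℕ)) fun b => ?_
  obtain ⟨c, hc, rfl⟩ := hgen b
  exact ⟨fun α => ⟨c α, hc α⟩, by simp [Fintype.linearCombination_apply, Subring.smul_def]⟩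

/-- `B₁` is a direct summand of the `B₁`-module `B`. -/
theorem exists_retraction (hp : 0 < p) (h : IsFrobeniusPair p FA gr A₁) :
    ∃ r : B →ₗ[grImage FA gr A₁] grImage FA gr A₁, ∀ x : grImage FA gr A₁, r x = x := by
  obtain ⟨t, y, d, -, hgen, huniq⟩ := h.basis
  choose c hc hb using hgen
  let o : Fin t → Fin p := fun _ => ⟨0, hp⟩
  refine ⟨{ toFun := fun b => ⟨c b o, hc b o⟩, map_add' := ?_, map_smul' := ?_ }, ?_⟩
  · intro b b'
    have := huniq (c (b + b')) (c b + c b') (hc _) (fun α => add_mem (hc b α) (hc b' α)) (by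
      rw [← hb]
      simp only [Pi.add_apply, add_mul, Finset.sum_add_distrib]
      rw [← hb, ← hb])
    exact Subtype.ext (congrFun this o)
  · intro s b
    have := huniq (c (s • b)) (fun α => s * c b α) (hc _) (fun α => mul_mem s.2 (hc b α)) (by
      rw [← hb]
      simp only [mul_assoc, ← Finset.mul_sum]
      rw [← hb, Subring.smul_def, smul_eq_mul])
    exact Subtype.ext (congrFun this o)
  · intro x
    have := huniq (c x) (Pi.single o (x : B)) (hc _) (fun α => by
      by_cases hα : α = o
      · subst hα; simp
      · simp [hα]) (by
      rw [← hb, Finset.sum_eq_single o]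
      · simp [o]
      · intro α _ hα; simp [hα]
      · simp)
    refine Subtype.ext ((congrFun this o).trans ?_)
    simp

theorem comap_map_subtype (hp : 0 < p) (h : IsFrobeniusPair p FA gr A₁)
    (𝔞 : Ideal (grImage FA gr A₁)) :
    (𝔞.map (grImage FA gr A₁).subtype).comap (grImage FA gr A₁).subtype = 𝔞 := by
  obtain ⟨r, hr⟩ := h.exists_retraction hp
  refine le_antisymm (fun x hx => ?_) Ideal.le_comap_map
  have key : ∀ z ∈ 𝔞.map (grImage FA gr A₁).subtype, ∀ b : B, r (b * z) ∈ 𝔞 := by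
    intro z hz
    induction hz using Submodule.span_induction with
    | mem z hz =>
      obtain ⟨a, ha, rfl⟩ := hz
      intro b
      have e : b * (grImage FA gr A₁).subtype a = a • b := by
        rw [mul_comm]; rfl
      rw [e, map_smul]
      exact 𝔞.mul_mem_right _ ha
    | zero => simp
    | add z w _ _ hz hw => intro b; rw [mul_add, map_add]; exact add_mem (hz b) (hw b)
    | smul c z _ hz => intro b; rw [smul_eq_mul, ← mul_assoc]; exact hz _
  have := key _ hx 1
  rwa [one_mul, Subring.subtype_apply, hr] at this

theorem isNoetherianRing_grImage (hp : 0 < p) (h : IsFrobeniusPair p FA gr A₁) :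
    IsNoetherianRing (grImage FA gr A₁) := by
  have := h.noetherian
  have hmono : StrictMono (Ideal.map (grImage FA gr A₁).subtype) :=
    Monotone.strictMono_of_injective (fun _ _ => Ideal.map_mono)
      (Function.LeftInverse.injective (h.comap_map_subtype hp))
  exact isNoetherian_iff'.2 hmono.wellFoundedGT

/-- The filtration induced on an `A₁`-submodule `J` of `A` is good. -/
theorem exists_good_generators (hp : 0 < p) (h : IsFrobeniusPair p FA gr A₁)
    {J : AddSubgroup A} (hJ : ∀ f ∈ J, ∀ a ∈ A₁, f * a ∈ J) :
    ∃ (T : Finset B) (g : T → A) (d : T → ℤ), (∀ t, g t ∈ J) ∧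
      ∀ (m : ℤ) (f : A), f ∈ FA.F m → f ∈ J → ∃ a : T → A,
        (∀ t, a t ∈ A₁ ∧ a t ∈ FA.F (m - d t)) ∧ f = ∑ t, g t * a t := by
  have := h.isNoetherianRing_grImage hp
  have := h.moduleFinite
  have hfg : (Submodule.span (grImage FA gr A₁) (grSet FA gr (J : Set A))).FG :=
    IsNoetherian.noetherian _
  obtain ⟨T, hT, hspan⟩ := Submodule.fg_span_iff_fg_span_finset_subset _ |>.1 hfg
  choose d g hgJ hg using fun t : T => mem_grSet.1 (hT t.2)
  refine ⟨T, g, d, hgJ, fun m f hf hfJ => ?_⟩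
  refine h.complete.exists_eq_sum h.closed hJ hgJ (fun t => (hg t).1) ?_ hf hfJ
  intro m f hf hfJ
  have hs : gr.IsSymbol m f (gr.σ m ⟨f, hf⟩) := ⟨hf, rfl⟩
  have hmem : gr.σ m ⟨f, hf⟩ ∈ Submodule.span (grImage FA gr A₁) (T : Set B) := by
    rw [← hspan]
    exact Submodule.subset_span (mem_grSet.2 ⟨m, f, hfJ, hs⟩)
  obtain ⟨c, -, hc⟩ := Submodule.mem_span_finset.1 hmem
  choose a haA ha using fun t : T =>
    exists_isSymbol_comp_of_mem_grImage (gr := gr) (c t).2 (m - d t)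
  refine ⟨a, fun t => ⟨haA t, (ha t).1⟩, GradedOf.IsSymbol.zero_iff (gr := gr).1 ?_⟩
  have hsum : gr.σ m ⟨f, hf⟩ = ∑ t : T, (t : B) * gr.comp (m - d t) (c t) := by
    rw [← gr.comp_of_mem hs.mem_deg, ← hc, map_sum, ← Finset.sum_coe_sort]
    refine Finset.sum_congr rfl fun t _ => ?_
    rw [Subring.smul_def, smul_eq_mul, gr.comp_mul_of_mem (hg t).mem_deg, mul_comm]
  have := hs.sub (GradedOf.IsSymbol.sum (gr := gr) (n := m) Finset.univ
    (x := fun t : T => g t * a t) (b := fun t : T => (t : B) * gr.comp (m - d t) (c t))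
    fun t _ => by simpa using (hg t).mul (ha t))
  rwa [← hsum, sub_self] at this

theorem exists_pow_mem_grSet_inter (hp : 0 < p) (h : IsFrobeniusPair p FA gr A₁)
    (I : Submodule Aᵐᵒᵖ A) {b : B} (hb : b ∈ grSet FA gr (I : Set A)) :
    ∃ N : ℕ, b ^ N ∈ grSet FA gr ((I : Set A) ∩ (A₁ : Set A)) := by
  obtain ⟨n, x, hxI, hx⟩ := mem_grSet.1 hb
  have hxp := hx.pow p
  have hxpI : x ^ p ∈ I := by
    obtain ⟨k, rfl⟩ := Nat.exists_eq_succ_of_ne_zero hp.ne'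
    rw [Nat.succ_eq_add_one, pow_succ']
    exact I.smul_mem (.op (x ^ k)) hxI
  obtain ⟨y, hyA, hy⟩ := exists_isSymbol_comp_of_mem_grImage (gr := gr) (h.frob b) (p * n)
  rw [gr.comp_of_mem hxp.mem_deg] at hy
  generalize (p : ℤ) * n = q at *
  let J : AddSubgroup A := A₁.toAddSubgroup ⊔ I.toAddSubgroup
  have hJ : ∀ f ∈ J, ∀ a ∈ A₁, f * a ∈ J := by
    intro f hf a ha
    obtain ⟨g, hg, i, hi, rfl⟩ := AddSubgroup.mem_sup.1 hf
    rw [add_mul]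
    exact AddSubgroup.add_mem_sup (A₁.mul_mem hg ha) (I.smul_mem (.op a) hi)
  obtain ⟨T, g, d, hgJ, hgen⟩ := h.exists_good_generators hp hJ
  choose g₁ hg₁ g₂ hg₂ hg using fun t => AddSubgroup.mem_sup.1 (hgJ t)
  choose e he using fun t => FA.exhaustive (g₁ t)
  obtain ⟨D, hD⟩ : ∃ D : ℕ, ∀ t, e t - d t ≤ D := by
    refine ⟨∑ t, (e t - d t).natAbs, fun t => ?_⟩
    have := Finset.single_le_sum (f := fun t => (e t - d t).natAbs) (fun _ _ => Nat.zero_le _)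
      (Finset.mem_univ t)
    omega
  obtain ⟨i, hi, hF⟩ := hxp.exists_pow_sub_mem hxpI hy (D + 1)
  have hfJ : y ^ (D + 1) - i ∈ J := by
    rw [sub_eq_add_neg]
    exact AddSubgroup.add_mem_sup (A₁.pow_mem hyA _) (I.neg_mem hi)
  obtain ⟨a, ha, hsum⟩ := hgen _ _ hF hfJ
  have hGA : ∑ t, g₁ t * a t ∈ A₁ := sum_mem fun t _ => A₁.mul_mem (hg₁ t) (ha t).1
  have hGF : ∑ t, g₁ t * a t ∈ FA.F (((D + 1 : ℕ) : ℤ) * q - 1) := by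
    refine sum_mem fun t _ => FA.mono ?_ (FA.mul_mem (he t) (ha t).2)
    have := hD t
    rw [mul_sub]
    push_cast
    linarith
  have hHI : ∑ t, g₂ t * a t ∈ I := sum_mem fun t _ => I.smul_mem (.op (a t)) (hg₂ t)
  have heq : y ^ (D + 1) - ∑ t, g₁ t * a t = i + ∑ t, g₂ t * a t := by
    simp only [← hg, add_mul, Finset.sum_add_distrib] at hsum
    rw [sub_eq_iff_eq_add] at hsum ⊢
    rw [hsum]; abel
  have hmem : y ^ (D + 1) - ∑ t, g₁ t * a t ∈ (I : Set A) ∩ A₁ := by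
    refine ⟨?_, sub_mem (A₁.pow_mem hyA _) hGA⟩
    rw [heq]
    exact add_mem hi hHI
  have hs := (hy.pow (D + 1)).sub (GradedOf.IsSymbol.zero_iff.2 hGF)
  rw [sub_zero, ← pow_mul] at hs
  exact ⟨p * (D + 1), mem_grSet.2 ⟨_, _, hmem, hs⟩⟩

/-- Every graded prime of `B₁` is the contraction of a graded prime of `B`. -/
theorem exists_isHomog_comap_eq (hp : p.Prime) (hpA : (p : A) = 0)
    (h : IsFrobeniusPair p FA gr A₁) (𝔭 : Ideal (grImage FA gr A₁)) [h𝔭 : 𝔭.IsPrime]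
    (hhom : ∀ x ∈ 𝔭, ∀ n : ℤ,
      gr.comp n (x : B) ∈ (fun y : grImage FA gr A₁ => (y : B)) '' 𝔭) :
    ∃ P : Ideal B, P.IsPrime ∧ gr.IsHomog (P : Set B) ∧
      P.comap (grImage FA gr A₁).subtype = 𝔭 := by
  have := h.domain
  have : Fact p.Prime := ⟨hp⟩
  have : CharP B p := by
    obtain rfl := CharP.ringChar_of_prime_eq_zero hp (natCast_eq_zero_of_gr hpA gr)
    infer_instance
  set P := (𝔭.map (grImage FA gr A₁).subtype).radical with hP
  have hcomap : P.comap (grImage FA gr A₁).subtype = 𝔭 := by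
    rw [hP, Ideal.comap_radical, h.comap_map_subtype hp.pos, h𝔭.radical]
  have hiff (b : B) : b ∈ P ↔ (⟨b ^ p, h.frob b⟩ : grImage FA gr A₁) ∈ 𝔭 := by
    rw [← hcomap, Ideal.mem_comap, Subring.subtype_apply]
    exact ⟨fun hb => P.pow_mem_of_mem hb p hp.pos, fun hb => Ideal.radical_isRadical _ ⟨p, hb⟩⟩
  refine ⟨P, ⟨fun htop => h𝔭.ne_top (by rw [← hcomap, htop, Ideal.comap_top]), ?_⟩, ?_, hcomap⟩
  · intro x y hxy
    rw [hiff, hiff]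
    rw [hiff] at hxy
    refine h𝔭.mem_or_mem ?_
    convert hxy using 1
    exact Subtype.ext (mul_pow x y p).symm
  · intro b hb n
    have hb := (hiff b).1 hb
    obtain ⟨z, hz, hzb⟩ := hhom _ hb (p * n)
    rw [SetLike.mem_coe, hiff]
    suffices e : (⟨gr.comp n b ^ p, h.frob _⟩ : grImage FA gr A₁) = z from e ▸ hz
    refine Subtype.ext (Eq.trans ?_ hzb.symm)
    have hfin := gr.comp_finite b
    have hpow : b ^ p = ∑ᶠ j : ℤ, (gr.comp j b) ^ p := by
      conv_lhs => rw [← gr.comp_sum b]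
      exact (frobenius B p).toAddMonoidHom.map_finsum hfin
    have hfin' : (Function.support fun j => (gr.comp j b) ^ p).Finite :=
      hfin.subset fun j hj h0 => hj (by simp only [h0, zero_pow hp.ne_zero])
    change gr.comp n b ^ p = gr.comp (p * n) (b ^ p)
    rw [hpow, AddMonoidHom.map_finsum _ hfin', finsum_eq_single _ n]
    · exact (gr.comp_of_mem (gr.pow_mem (gr.comp_mem n b) p)).symm
    · intro j hj
      refine gr.comp_eq_zero (gr.pow_mem (gr.comp_mem j b) p) fun e => hj ?_
      exact (mul_left_cancel₀ (Nat.cast_ne_zero.2 hp.ne_zero) e).symm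

end IsFrobeniusPair


/-- Ardakov–Wadsley, Proposition 2.5 / §2.5.
For a Frobenius pair `(A, A₁)`, the contraction map `ι_* : Spec_gr(B) → Spec_gr(B₁)`,
`ι_*(P) = P ∩ B₁`, is a bijection with inverse `𝔭 ↦ √(𝔭B)`; moreover for a right ideal `I`
of `A` with `I₁ = I ∩ A₁` one has `Ch(A/I) = Ch(A/I₁A) = ι_*⁻¹(Ch(A₁/I₁))`. -/
theorem contraction_bijective_and_characteristic_support
    (p : ℕ) (hp : p.Prime) (k : Type) [Field k] [CharP k p]
    {A B : Type} [Ring A] [CommRing B] [Algebra k A]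
    (FA : FilteredRing A) (gr : GradedOf FA B) (A₁ : Subring A)
    (halg : ∀ c : k, algebraMap k A c ∈ A₁)
    (hFP : IsFrobeniusPair p FA gr A₁)
    (I : Submodule Aᵐᵒᵖ A) :
    -- `ι_*` is injective on graded primes of `B` :
    (∀ P P' : Ideal B, P.IsPrime → gr.IsHomog (P : Set B) →
      P'.IsPrime → gr.IsHomog (P' : Set B) →
      P.comap (grImage FA gr A₁).subtype = P'.comap (grImage FA gr A₁).subtype → P = P') ∧
    -- `ι_*` is surjective onto graded primes of `B₁` :
    (∀ 𝔭 : Ideal (grImage FA gr A₁), 𝔭.IsPrime →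
      (∀ x ∈ 𝔭, ∀ n : ℤ, gr.comp n (x : B) ∈ (fun y : grImage FA gr A₁ => (y : B)) '' 𝔭) →
      ∃ P : Ideal B, P.IsPrime ∧ gr.IsHomog (P : Set B) ∧
        P.comap (grImage FA gr A₁).subtype = 𝔭) ∧
    -- the inverse of `ι_*` is given by `𝔭 ↦ √(𝔭B)` :
    (∀ P : Ideal B, P.IsPrime → gr.IsHomog (P : Set B) →
      P = (Ideal.span ((P : Set B) ∩ (grImage FA gr A₁ : Set B))).radical) ∧
    -- `Ch(A/I) = Ch(A/I₁A) = ι_*⁻¹(Ch(A₁/I₁))` :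
    (∀ P : Ideal B, P.IsPrime → gr.IsHomog (P : Set B) →
      ((grIdeal FA gr (I : Set A) ≤ P ↔
        grIdeal FA gr
          ((Submodule.span Aᵐᵒᵖ ((I : Set A) ∩ (A₁ : Set A)) : Submodule Aᵐᵒᵖ A) : Set A) ≤ P) ∧
       (grIdeal FA gr (I : Set A) ≤ P ↔
        ∀ b ∈ grSet FA gr ((I : Set A) ∩ (A₁ : Set A)), b ∈ P))) := by
  have hpA : (p : A) = 0 := by
    rw [← map_natCast (algebraMap k A), CharP.cast_eq_zero, map_zero]
  refine ⟨?_, fun 𝔭 h𝔭 hhom => hFP.exists_isHomog_comap_eq hp hpA 𝔭 hhom, ?_, ?_⟩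
  · intro P P' hP _ hP' _ heq
    ext b
    rw [← hP.pow_mem_iff_mem p hp.pos, ← hP'.pow_mem_iff_mem p hp.pos]
    exact SetLike.ext_iff.1 heq ⟨b ^ p, hFP.frob b⟩
  · intro P hP _
    refine le_antisymm (fun b hb => ⟨p, Ideal.subset_span
      ⟨P.pow_mem_of_mem hb p hp.pos, hFP.frob b⟩⟩) ?_
    exact hP.isRadical.radical_le_iff.2 (Ideal.span_le.2 Set.inter_subset_left)
  · intro P hP _
    have hmono {S S' : Set A} (h : S ⊆ S') : grSet FA gr S ⊆ grSet FA gr S' :=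
      fun _ ⟨n, x, hx, e⟩ => ⟨n, x, h hx, e⟩
    have hle : ((Submodule.span Aᵐᵒᵖ ((I : Set A) ∩ A₁) : Submodule Aᵐᵒᵖ A) : Set A) ⊆ I :=
      Submodule.span_le.2 Set.inter_subset_left
    have h12 (h : grIdeal FA gr (I : Set A) ≤ P) := (Ideal.span_mono (hmono hle)).trans h
    have h31 (h : ∀ b ∈ grSet FA gr ((I : Set A) ∩ A₁), b ∈ P) :
        grIdeal FA gr (I : Set A) ≤ P := by
      refine Ideal.span_le.2 fun b hb => ?_
      obtain ⟨N, hN⟩ := hFP.exists_pow_mem_grSet_inter hp.pos I hb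
      exact hP.mem_of_pow_mem N (h _ hN)
    exact ⟨⟨h12, fun h => h31 fun b hb =>
        h (Ideal.subset_span (hmono Submodule.subset_span hb))⟩,
      fun h b hb => h (Ideal.subset_span (hmono Set.inter_subset_left hb)), h31⟩
end

section
/- Let A be a filtered ring with associated graded ring B = gr A, and let α be a ring endomorphism of A such that there is an integer m ≥ 1 with (α − 1)(F_nA) ⊆ F_{n−m}A for all n ∈ ℤ. Then the map d_α : B → B, defined on each homogeneous component by d_α(x + F_{n−1}A) = α(x) − x + F_{n−m−1}A for x ∈ F_nA, is a graded derivation of B of degree −m, i.e. an additive graded map of degree −m satisfying d_α(XY) = d_α(X)Y + X d_α(Y) for all X, Y ∈ B. -/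
variable {A B : Type}

namespace GradedOf

lemma σ_congr [Ring A] [Ring B] {FA : FilteredRing A} (gr : GradedOf FA B) {k n : ℤ} (h : k = n)
    {x y : A} (hxy : x = y) (hx : x ∈ FA.F k) (hy : y ∈ FA.F n) :
    gr.σ k ⟨x, hx⟩ = gr.σ n ⟨y, hy⟩ := by
  subst h hxy
  rfl

/-- Additive induction on `gr A`: every element is a sum of symbols. -/
lemma induction_on_symbols [Ring A] [Ring B] {FA : FilteredRing A} (gr : GradedOf FA B)
    {P : B → Prop} (zero : P 0) (add : ∀ x y, P x → P y → P (x + y))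
    (symbol : ∀ (n : ℤ) (x : FA.F n), P (gr.σ n x)) (b : B) : P b := by
  rw [← gr.comp_sum b]
  refine finsum_induction P zero (fun _ _ => add _ _) fun n => ?_
  obtain ⟨x, hx⟩ := gr.σ_surj n _ (gr.comp_mem n b)
  exact hx ▸ symbol n x

end GradedOf

/-- The Leibniz rule for the map induced by `α - 1`, on symbols. -/
lemma leibniz_on_symbols [Ring A] [Ring B]
    (FA : FilteredRing A) (gr : GradedOf FA B) (α : A →+* A) (m : ℤ) (hm : 1 ≤ m)
    (hα : ∀ n : ℤ, ∀ x ∈ FA.F n, α x - x ∈ FA.F (n - m)) (d : B →+ B)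
    (hd : ∀ (n : ℤ) (x : FA.F n) (h : α (x : A) - (x : A) ∈ FA.F (n - m)),
      d (gr.σ n x) = gr.σ (n - m) ⟨α (x : A) - (x : A), h⟩)
    (k n : ℤ) (x : FA.F k) (y : FA.F n) :
    d (gr.σ k x * gr.σ n y) = d (gr.σ k x) * gr.σ n y + gr.σ k x * d (gr.σ n y) := by
  obtain ⟨x, hx⟩ := x
  obtain ⟨y, hy⟩ := y
  have hx' := hα k x hx
  have hy' := hα n y hy
  have hxy := FA.mul_mem hx hy
  have h₁ := FA.mul_mem hx' hy
  have h₂ := FA.mul_mem hx hy'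
  have e₁ : k - m + n = k + n - m := by ring
  have e₂ : k + (n - m) = k + n - m := by ring
  have h₁' : (α x - x) * y ∈ FA.F (k + n - m) := e₁ ▸ h₁
  have h₂' : x * (α y - y) ∈ FA.F (k + n - m) := e₂ ▸ h₂
  rw [← gr.σ_mul ⟨x, hx⟩ ⟨y, hy⟩ hxy, hd _ _ (hα _ _ hxy), hd _ _ hx', hd _ _ hy',
    ← gr.σ_mul ⟨α x - x, hx'⟩ ⟨y, hy⟩ h₁, ← gr.σ_mul ⟨x, hx⟩ ⟨α y - y, hy'⟩ h₂,
    gr.σ_congr e₁ rfl h₁ h₁', gr.σ_congr e₂ rfl h₂ h₂', ← map_add, ← sub_eq_zero, ← map_sub,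
    gr.σ_ker]
  have h₃ : (α x - x) * (α y - y) ∈ FA.F (k + n - m - 1) :=
    FA.mono (by linarith) (FA.mul_mem hx' hy')
  convert h₃ using 1
  simp only [AddSubgroup.coe_sub, AddSubgroup.coe_add, map_mul]
  noncomm_ring

/-- Ardakov–Wadsley, Lemma 3.1 / §3.1.
Let `A` be a filtered ring with associated graded ring `B = gr A` and let `α` be a ring
endomorphism of `A` with `(α − 1)(F_nA) ⊆ F_{n−m}A` for all `n`, for some `m ≥ 1`.  Then the
induced map `d_α : B → B`, defined on symbols by `d_α(gr_n x) = gr_{n-m}(α(x) − x)`, is a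
graded derivation of `B` lowering degrees by `m`. -/
theorem induced_graded_derivation
    {A B : Type} [Ring A] [Ring B]
    (FA : FilteredRing A) (gr : GradedOf FA B)
    (α : A →+* A) (m : ℤ) (hm : 1 ≤ m)
    (hα : ∀ n : ℤ, ∀ x ∈ FA.F n, α x - x ∈ FA.F (n - m))
    -- `d` is the additive map induced by `α − 1` on each homogeneous component :
    (d : B →+ B)
    (hd : ∀ (n : ℤ) (x : FA.F n) (h : α (x : A) - (x : A) ∈ FA.F (n - m)),
      d (gr.σ n x) = gr.σ (n - m) ⟨α (x : A) - (x : A), h⟩) :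
    -- then `d` is graded of degree `−m` and is a derivation :
    (∀ n : ℤ, ∀ b ∈ gr.deg n, d b ∈ gr.deg (n - m)) ∧
    (∀ X Y : B, d (X * Y) = d X * Y + X * d Y) := by
  refine ⟨fun n b hb => ?_, fun X Y => ?_⟩
  · obtain ⟨x, rfl⟩ := gr.σ_surj n b hb
    rw [hd n x (hα n x x.2)]
    exact gr.σ_mem _ _
  · induction X using gr.induction_on_symbols with
    | zero => simp
    | add X X' hX hX' => simp only [add_mul, map_add, hX, hX']; abel
    | symbol k x =>
      induction Y using gr.induction_on_symbols with
      | zero => simp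
      | add Y Y' hY hY' => simp only [mul_add, map_add, hY, hY']; abel
      | symbol n y => exact leibniz_on_symbols FA gr α m hm hα d hd k n x y
end
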